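/- Let Λ = (Λ_j)_{j∈J} be an (A,B) g-frame of (H,(H_j)) and Θ = (θ_j)_{j∈J} a g-Bessel family of (H,(H_j)). If there exists a constant M > 0 such that Σ_{j∈J} ‖Λ_j f − θ_j f‖² ≤ M Σ_{j∈J} ‖θ_j f‖² for all f ∈ H, then Θ is a g-frame; more precisely, (A/(2M+2))‖f‖² ≤ Σ_{j∈J} ‖θ_j f‖² for all f ∈ H. -/

import Mathlib

open scoped ComplexInnerProductSpace

noncomputable section

variable {J H : Type*} [NormedAddCommGroup H] [InnerProductSpace ℂ H] [CompleteSpace H]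
  {G : J → Type*} [∀ j, NormedAddCommGroup (G j)] [∀ j, InnerProductSpace ℂ (G j)]
  [∀ j, CompleteSpace (G j)]

/-- `Λ` is an `(A,B)` g-frame of `(H, (G j))`. -/
def IsGFrameWith (Λ : ∀ j, H →L[ℂ] G j) (A B : ℝ) : Prop :=
  0 < A ∧ A ≤ B ∧ ∀ f : H,
    Summable (fun j => ‖Λ j f‖ ^ 2) ∧
    A * ‖f‖ ^ 2 ≤ ∑' j, ‖Λ j f‖ ^ 2 ∧
    ∑' j, ‖Λ j f‖ ^ 2 ≤ B * ‖f‖ ^ 2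

/-- `Λ` is a g-frame. -/
def IsGFrame (Λ : ∀ j, H →L[ℂ] G j) : Prop :=
  ∃ A B : ℝ, IsGFrameWith Λ A B

/-- `Λ` is a g-Bessel family with bound `B`. -/
def IsGBessel (Λ : ∀ j, H →L[ℂ] G j) (B : ℝ) : Prop :=
  0 < B ∧ ∀ f : H,
    Summable (fun j => ‖Λ j f‖ ^ 2) ∧ ∑' j, ‖Λ j f‖ ^ 2 ≤ B * ‖f‖ ^ 2

/-- The family `θ` is g-orthonormal. -/
def GOrthonormal (θ : ∀ j, H →L[ℂ] G j) : Prop :=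
  (∀ j k, j ≠ k → ∀ (f : G j) (g : G k),
    ⟪ContinuousLinearMap.adjoint (θ j) f, ContinuousLinearMap.adjoint (θ k) g⟫ = 0) ∧
  ∀ j, ∀ f g : G j,
    ⟪ContinuousLinearMap.adjoint (θ j) f, ContinuousLinearMap.adjoint (θ j) g⟫ = ⟪f, g⟫

/-- The family `θ` is a g-orthonormal basis. -/
def GONBasis (θ : ∀ j, H →L[ℂ] G j) : Prop :=
  GOrthonormal θ ∧ ∀ f : H, HasSum (fun j => ‖θ j f‖ ^ 2) (‖f‖ ^ 2)

/-- `Λ` is a g-Riesz basis: `Λ j = θ j ∘ X` for a g-orthonormal basis `θ` and a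
bounded operator `X` with bounded inverse. -/
def IsGRieszBasis (Λ : ∀ j, H →L[ℂ] G j) : Prop :=
  ∃ (X Xinv : H →L[ℂ] H) (θ : ∀ j, H →L[ℂ] G j),
    X.comp Xinv = ContinuousLinearMap.id ℂ H ∧
    Xinv.comp X = ContinuousLinearMap.id ℂ H ∧
    GONBasis θ ∧ ∀ j, Λ j = (θ j).comp X

/-- `S` is the g-frame operator of `Λ`: `S f = Σ_j Λ_j* (Λ_j f)`. -/
def IsGFrameOp (Λ : ∀ j, H →L[ℂ] G j) (S : H →L[ℂ] H) : Prop :=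
  ∀ f : H, HasSum (fun j => ContinuousLinearMap.adjoint (Λ j) (Λ j f)) (S f)

/-- `Γ` is a dual g-frame of `Λ`: it is a g-frame and `f = Σ_j Γ_j* (Λ_j f)`. -/
def IsDualGFrame (Λ Γ : ∀ j, H →L[ℂ] G j) : Prop :=
  IsGFrame Γ ∧ ∀ f : H, HasSum (fun j => ContinuousLinearMap.adjoint (Γ j) (Λ j f)) f


theorem norm_sq_le_two_mul_norm_sub_sq_add {E : Type*} [SeminormedAddCommGroup E] (x y : E) :
    ‖x‖ ^ 2 ≤ 2 * (‖x - y‖ ^ 2 + ‖y‖ ^ 2) := by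
  have hxy : ‖x‖ ≤ ‖x - y‖ + ‖y‖ := by simpa using norm_add_le (x - y) y
  calc ‖x‖ ^ 2 ≤ (‖x - y‖ + ‖y‖) ^ 2 := by gcongr
    _ ≤ 2 * (‖x - y‖ ^ 2 + ‖y‖ ^ 2) := add_sq_le

theorem summable_norm_sub_sq {ι : Type*} {E : ι → Type*} [∀ i, SeminormedAddCommGroup (E i)]
    {x y : ∀ i, E i} (hx : Summable fun i => ‖x i‖ ^ 2) (hy : Summable fun i => ‖y i‖ ^ 2) :
    Summable fun i => ‖x i - y i‖ ^ 2 := by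
  refine .of_nonneg_of_le (fun i => by positivity) (fun i => ?_) ((hx.add hy).mul_left 2)
  calc ‖x i - y i‖ ^ 2 ≤ (‖x i‖ + ‖y i‖) ^ 2 := by gcongr; exact norm_sub_le _ _
    _ ≤ 2 * (‖x i‖ ^ 2 + ‖y i‖ ^ 2) := add_sq_le

theorem tsum_norm_sq_le_two_mul {ι : Type*} {E : ι → Type*} [∀ i, SeminormedAddCommGroup (E i)]
    {x y : ∀ i, E i} (hx : Summable fun i => ‖x i‖ ^ 2) (hy : Summable fun i => ‖y i‖ ^ 2) :
    ∑' i, ‖x i‖ ^ 2 ≤ 2 * (∑' i, ‖x i - y i‖ ^ 2 + ∑' i, ‖y i‖ ^ 2) := by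
  have hxy := summable_norm_sub_sq hx hy
  rw [← hxy.tsum_add hy, ← tsum_mul_left]
  exact hx.tsum_le_tsum (fun i => norm_sq_le_two_mul_norm_sub_sq_add _ _) ((hxy.add hy).mul_left 2)

/-- If `Λ` is an `(A,B)` g-frame, `Θ` is a g-Bessel family and
`Σ_j ‖Λ_j f − θ_j f‖² ≤ M Σ_j ‖θ_j f‖²` for all `f`, then `Θ` is a g-frame with lower
bound `A/(2M+2)`. -/
theorem stmt_12 (Λ Θ : ∀ j, H →L[ℂ] G j) (A B C : ℝ)
    (hΛ : IsGFrameWith Λ A B) (hΘ : IsGBessel Θ C)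
    (M : ℝ) (hM : 0 < M)
    (h : ∀ f : H, ∑' j, ‖Λ j f - Θ j f‖ ^ 2 ≤ M * ∑' j, ‖Θ j f‖ ^ 2) :
    IsGFrame Θ ∧ ∀ f : H, A / (2 * M + 2) * ‖f‖ ^ 2 ≤ ∑' j, ‖Θ j f‖ ^ 2 := by
  obtain ⟨hA, -, hΛ⟩ := hΛ
  obtain ⟨-, hΘ⟩ := hΘ
  have lower (f : H) : A / (2 * M + 2) * ‖f‖ ^ 2 ≤ ∑' j, ‖Θ j f‖ ^ 2 := by
    rw [div_mul_eq_mul_div, div_le_iff₀ (by positivity)]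
    linarith [(hΛ f).2.1, tsum_norm_sq_le_two_mul (hΛ f).1 (hΘ f).1, h f]
  refine ⟨⟨A / (2 * M + 2), max (A / (2 * M + 2)) C, by positivity, le_max_left _ _,
    fun f => ⟨(hΘ f).1, lower f, (hΘ f).2.trans ?_⟩⟩, lower⟩
  gcongr
  exact le_max_right _ _

end
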